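/- Let X be an ε_d-full nearest neighbor Z^d SFT (ε_d = 1/(3³·2¹¹·d⁸)) with unique measure of maximal entropy μ. Then every globally admissible configuration u whose inner boundary consists only of good letters has μ([u]) > 0. -/

import Mathlib

open MeasureTheory

abbrev Site (d : ℕ) := Fin d → ℤ

def unitVec (d : ℕ) (i : Fin d) : Site d := fun j => if j = i then 1 else 0

def adjSites {d : ℕ} (u v : Site d) : Prop :=
  ∃ i : Fin d, v = u + unitVec d i ∨ u = v + unitVec d i

def innerBd {d : ℕ} (S : Set (Site d)) : Set (Site d) :=
  {v | v ∈ S ∧ ∃ u, u ∉ S ∧ adjSites v u}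

def outerBd {d : ℕ} (S : Set (Site d)) : Set (Site d) :=
  {v | v ∉ S ∧ ∃ u, u ∈ S ∧ adjSites v u}

def cube (d n : ℕ) : Set (Site d) := {v | ∀ i, 1 ≤ v i ∧ v i ≤ (n : ℤ)}

def symBox (d n : ℕ) : Set (Site d) := {v | ∀ i, |v i| ≤ (n : ℤ)}

def symBoxR (d : ℕ) (r : ℝ) : Set (Site d) := {v | ∀ i, |((v i : ℤ) : ℝ)| ≤ r}

/-- A nearest neighbor `ℤ^d` SFT is specified by its allowed adjacent pairs
in each of the `d` cardinal directions: `adj i a b` means the pair `a b` may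
appear at sites `v, v + e i`. -/
structure NNSFT (d : ℕ) (A : Type) where
  adj : Fin d → A → A → Prop

namespace NNSFT

variable {d : ℕ} {A : Type}

/-- The points of the subshift. -/
def pts (X : NNSFT d A) : Set (Site d → A) :=
  {x | ∀ (i : Fin d) (v : Site d), X.adj i (x v) (x (v + unitVec d i))}

/-- A configuration on shape `S` is locally admissible if it contains no
forbidden adjacent pair inside `S`. -/
def locAdm (X : NNSFT d A) (S : Set (Site d)) (w : Site d → A) : Prop :=
  ∀ (i : Fin d) (v : Site d), v ∈ S → v + unitVec d i ∈ S →
    X.adj i (w v) (w (v + unitVec d i))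

/-- A configuration on shape `S` is globally admissible if it extends to a
point of the subshift. -/
def globAdm (X : NNSFT d A) (S : Set (Site d)) (w : Site d → A) : Prop :=
  ∃ x ∈ X.pts, ∀ v ∈ S, x v = w v

/-- `X` is `ε`-full with good-letter set `G`. -/
def epsFullWith [Fintype A] (X : NNSFT d A) (ε : ℝ) (G : Set A) : Prop :=
  ((G.ncard : ℝ) > (1 - ε) * Fintype.card A) ∧
  ∀ g ∈ G, ∀ i : Fin d,
    (({a : A | X.adj i g a}.ncard : ℝ) > (1 - ε) * Fintype.card A) ∧
    (({a : A | X.adj i a g}.ncard : ℝ) > (1 - ε) * Fintype.card A)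

/-- `X` is `ε`-full. -/
def epsFull [Fintype A] (X : NNSFT d A) (ε : ℝ) : Prop :=
  ∃ G : Set A, X.epsFullWith ε G

/-- The globally admissible patterns on shape `S`. -/
def langSet (X : NNSFT d A) (S : Set (Site d)) : Set (S → A) :=
  (fun x => S.restrict x) '' X.pts

/-- The number of globally admissible patterns on shape `S`. -/
noncomputable def langCard (X : NNSFT d A) (S : Set (Site d)) : ℕ :=
  (X.langSet S).ncard

/-- Topological entropy, as the infimum (= limit, by subadditivity) of the
normalized log-counts of globally admissible patterns on cubes. -/
noncomputable def entropy (X : NNSFT d A) : ℝ :=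
  ⨅ n : ℕ+, Real.log (X.langCard (cube d (n : ℕ))) / ((n : ℕ) : ℝ) ^ d

end NNSFT

instance confMS (d : ℕ) (A : Type) : MeasurableSpace (Site d → A) :=
  @MeasurableSpace.pi (Site d) (fun _ => A) (fun _ => ⊤)

def shiftMap {d : ℕ} {A : Type} (t : Site d) (x : Site d → A) : Site d → A :=
  fun v => x (v + t)

/-- Shift invariance of a measure on the full shift. -/
def shiftInv {d : ℕ} {A : Type} (μ : Measure (Site d → A)) : Prop :=
  ∀ t : Site d, Measure.map (shiftMap t) μ = μ

/-- The cylinder set of configurations agreeing with `w` on `S`. -/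
def cylEvent {d : ℕ} {A : Type} (S : Set (Site d)) (w : Site d → A) :
    Set (Site d → A) := {x | ∀ v ∈ S, x v = w v}

/-- Shannon entropy of the marginal of `μ` on the cube `[1,n]^d`. -/
noncomputable def blockEnt {d : ℕ} {A : Type} [Fintype A]
    (μ : Measure (Site d → A)) (n : ℕ) : ℝ :=
  ∑ w : (Fin d → Fin n) → A,
    Real.negMulLog
      ((μ {x | ∀ p : Fin d → Fin n, x (fun i => (p i : ℤ) + 1) = w p}).toReal)

/-- Measure-theoretic entropy, as the infimum (= limit, by subadditivity) of
normalized Shannon entropies of cube marginals. -/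
noncomputable def measEnt {d : ℕ} {A : Type} [Fintype A]
    (μ : Measure (Site d → A)) : ℝ :=
  ⨅ n : ℕ+, blockEnt μ (n : ℕ) / ((n : ℕ) : ℝ) ^ d

/-- `μ` is a measure of maximal entropy for `X`. -/
def NNSFT.isMME {d : ℕ} {A : Type} [Fintype A] (X : NNSFT d A)
    (μ : Measure (Site d → A)) : Prop :=
  IsProbabilityMeasure μ ∧ shiftInv μ ∧ μ X.pts = 1 ∧ measEnt μ = X.entropy

/-- `badConn bad S T x` : in the configuration `x` there is a path of
`bad`-letters from `S` to `T`. -/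
def badConn {d : ℕ} {A : Type} (bad : A → Prop) (S T : Set (Site d))
    (x : Site d → A) : Prop :=
  ∃ (L : ℕ) (p : ℕ → Site d), p 0 ∈ S ∧ p L ∈ T ∧
    (∀ j < L, adjSites (p j) (p (j + 1))) ∧ ∀ j ≤ L, bad (x (p j))

/-- A finite constraint system: letters of `A` are placed on the sites `V`, and `ok v v' a b` says
that `a` at `v` may stand next to `b` at `v'`. Each site has at most `Δ` neighbours, at most `e`
letters are not good, and a good letter excludes at most `e` letters at each neighbouring site. -/
structure GoodSystem (V A : Type) [Fintype V] [Fintype A] where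
  nbr : V → V → Prop
  nbr_symm : ∀ v v', nbr v v' → nbr v' v
  nbr_irrefl : ∀ v, ¬ nbr v v
  ok : V → V → A → A → Prop
  ok_symm : ∀ v v' a b, ok v v' a b → ok v' v b a
  good : Set A
  Δ : ℕ
  e : ℕ
  deg_le : ∀ v, {v' | nbr v v'}.ncard ≤ Δ
  bad_le : {a | a ∉ good}.ncard ≤ e
  ok_le : ∀ v v' g, nbr v v' → g ∈ good → {a | ¬ ok v v' a g}.ncard ≤ e

namespace GoodSystem

variable {V A : Type} [Fintype V] [Fintype A] (Y : GoodSystem V A)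

def Adm (w : V → A) : Prop := ∀ v v', Y.nbr v v' → Y.ok v v' (w v) (w v')

/-- Partial fillings of `C`, with the sites of `D ⊆ C` already filled. -/
def fillings (base f : V → A) (N C D : Finset V) : Set (V → A) :=
  {w | (∀ v ∉ D, w v = base v) ∧ (∀ v ∈ D, w v ∈ Y.good ∧ (v ∉ N → w v ≠ f v)) ∧
    ∀ v ∈ D, ∀ v', Y.nbr v v' → (v' ∈ D ∨ v' ∉ C) → Y.ok v v' (w v) (w v')}

lemma card_choices_ge (w : V → A) (a₀ : A) (P : Set V) (v : V)
    (hP : ∀ v' ∈ P, Y.nbr v v' → w v' ∈ Y.good) (p : Prop) (hp : p → 1 ≤ Y.e) :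
    Fintype.card A - (Y.Δ + 2) * Y.e ≤
      {a | a ∈ Y.good ∧ (p → a ≠ a₀) ∧ ∀ v' ∈ P, Y.nbr v v' → Y.ok v v' a (w v')}.ncard := by
  classical
  set T := {a | a ∈ Y.good ∧ (p → a ≠ a₀) ∧ ∀ v' ∈ P, Y.nbr v v' → Y.ok v v' a (w v')} with hT
  have hsub : Tᶜ ⊆ ({a | a ∉ Y.good} ∪ {a | p ∧ a = a₀}) ∪
      ⋃ v' ∈ Finset.univ.filter (fun v' => v' ∈ P ∧ Y.nbr v v'), {a | ¬ Y.ok v v' a (w v')} := by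
    intro a ha
    simp only [hT, Set.mem_compl_iff, Set.mem_ofPred_eq, not_and_or, not_forall] at ha
    simp only [Set.mem_union, Set.mem_ofPred_eq, Set.mem_iUnion, Finset.mem_filter,
      Finset.mem_univ, true_and]
    rcases ha with h | ⟨h, h'⟩ | ⟨v', h1, h2, h3⟩
    · exact Or.inl (Or.inl h)
    · exact Or.inl (Or.inr ⟨h, not_not.1 h'⟩)
    · exact Or.inr ⟨v', ⟨h1, h2⟩, h3⟩
  have h1 : {a | p ∧ a = a₀}.ncard ≤ Y.e := by
    by_cases h : p
    · simpa [h] using hp h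
    · simp [h]
  have h2 : (⋃ v' ∈ Finset.univ.filter (fun v' => v' ∈ P ∧ Y.nbr v v'),
      {a | ¬ Y.ok v v' a (w v')}).ncard ≤ Y.Δ * Y.e := by
    refine (Finset.set_ncard_biUnion_le _ _).trans ?_
    refine (Finset.sum_le_card_nsmul _ _ Y.e ?_).trans ?_
    · intro v' hv'
      simp only [Finset.mem_filter, Finset.mem_univ, true_and] at hv'
      exact Y.ok_le v v' _ hv'.2 (hP v' hv'.1 hv'.2)
    · rw [smul_eq_mul]
      refine Nat.mul_le_mul_right _ (le_trans ?_ (Y.deg_le v))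
      rw [← Set.ncard_coe_finset]
      refine Set.ncard_le_ncard ?_ (Set.toFinite _)
      intro v' hv'
      simpa using (by simpa using hv' : v' ∈ P ∧ Y.nbr v v').2
  have h3 : Tᶜ.ncard ≤ (Y.e + Y.e) + Y.Δ * Y.e := by
    refine (Set.ncard_le_ncard hsub (Set.toFinite _)).trans ((Set.ncard_union_le _ _).trans ?_)
    exact add_le_add ((Set.ncard_union_le _ _).trans (add_le_add Y.bad_le h1)) h2
  have h4 := Set.ncard_add_ncard_compl T
  rw [Nat.card_eq_fintype_card] at h4
  have : (Y.Δ + 2) * Y.e = (Y.e + Y.e) + Y.Δ * Y.e := by ring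
  omega

lemma card_fillings_ge (base f : V → A) (N C : Finset V)
    (hgood : ∀ v ∈ C, ∀ v' ∉ C, Y.nbr v v' → base v' ∈ Y.good)
    (hN : ∀ v ∈ C, v ∉ N → 1 ≤ Y.e) (D : Finset V) (hD : D ⊆ C) :
    (Fintype.card A - (Y.Δ + 2) * Y.e) ^ D.card ≤ (Y.fillings base f N C D).ncard := by
  classical
  induction D using Finset.induction_on with
  | empty =>
    have : base ∈ Y.fillings base f N C ∅ := by simp [fillings]
    rw [Finset.card_empty, pow_zero]
    exact Nat.succ_le_of_lt ((Set.ncard_pos (Set.toFinite _)).2 ⟨_, this⟩)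
  | insert v D hv ih =>
    have hvC : v ∈ C := hD (Finset.mem_insert_self _ _)
    have hDC : D ⊆ C := (Finset.subset_insert _ _).trans hD
    specialize ih hDC
    rw [Finset.card_insert_of_notMem hv, pow_succ]
    let ch : (V → A) → Set A := fun w => {a | a ∈ Y.good ∧ (v ∉ N → a ≠ f v) ∧
      ∀ v' ∈ {v' | v' ∈ D ∨ v' ∉ C}, Y.nbr v v' → Y.ok v v' a (w v')}
    have hch : ∀ w ∈ Y.fillings base f N C D,
        Fintype.card A - (Y.Δ + 2) * Y.e ≤ (ch w).ncard := by
      rintro w ⟨hw1, hw2, hw3⟩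
      refine Y.card_choices_ge w (f v) _ v ?_ (v ∉ N) (hN v hvC)
      rintro v' (h | h) hn
      · exact (hw2 v' h).1
      · rw [hw1 v' fun h' => h (hDC h')]; exact hgood v hvC v' h hn
    let F : Finset (V → A) := (Y.fillings base f N C D).toFinset
    have hF : F.card = (Y.fillings base f N C D).ncard := by
      rw [Set.ncard_eq_toFinset_card']
    rw [Set.ncard_eq_toFinset_card' (Y.fillings base f N C (insert v D))]
    calc _ ≤ F.card * (Fintype.card A - (Y.Δ + 2) * Y.e) := by
          rw [hF]; exact Nat.mul_le_mul_right _ ih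
      _ ≤ ∑ w ∈ F, (ch w).toFinset.card := by
          rw [← smul_eq_mul]
          refine Finset.card_nsmul_le_sum _ _ _ fun w hw => ?_
          rw [← Set.ncard_eq_toFinset_card']
          exact hch w (by simpa [F] using hw)
      _ = (F.sigma fun w => (ch w).toFinset).card := (Finset.card_sigma _ _).symm
      _ ≤ _ := by
          refine Finset.card_le_card_of_injOn (fun x => Function.update x.1 v x.2) ?_ ?_
          · rintro ⟨w, a⟩ hx
            simp only [Finset.coe_sigma, Set.mem_sigma_iff, Finset.mem_coe, F,
              Set.mem_toFinset] at hx
            obtain ⟨⟨hw1, hw2, hw3⟩, ha1, ha2, ha3⟩ := hx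
            simp only [Finset.mem_coe, Set.mem_toFinset]
            have hne : ∀ x ∈ D, x ≠ v := fun x hx h => hv (h ▸ hx)
            refine ⟨?_, ?_, ?_⟩
            · intro x hx
              rw [Finset.mem_insert, not_or] at hx
              rw [Function.update_of_ne hx.1, hw1 x hx.2]
            · intro x hx
              rcases Finset.mem_insert.1 hx with rfl | hx
              · simpa using ⟨ha1, ha2⟩
              · rw [Function.update_of_ne (hne x hx)]; exact hw2 x hx
            · intro x hx' y hxy hy
              rcases Finset.mem_insert.1 hx' with rfl | hx
              · have hyx : y ≠ x := fun h => Y.nbr_irrefl x (h ▸ hxy)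
                rw [Function.update_self, Function.update_of_ne hyx]
                refine ha3 y ?_ hxy
                simpa [hyx] using hy
              · rw [Function.update_of_ne (hne x hx)]
                by_cases hyv : y = v
                · subst hyv
                  rw [Function.update_self]
                  exact Y.ok_symm _ _ _ _ (ha3 x (Or.inl hx) (Y.nbr_symm _ _ hxy))
                · rw [Function.update_of_ne hyv]
                  refine hw3 x hx y hxy ?_
                  simpa [hyv] using hy
          · rintro ⟨w, a⟩ hx ⟨w', a'⟩ hx' h
            simp only [Finset.coe_sigma, Set.mem_sigma_iff, Finset.mem_coe, F,
              Set.mem_toFinset] at hx hx'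
            have h1 : a = a' := by simpa using congrFun h v
            subst h1
            have h2 : w = w' := by
              funext x
              by_cases hxv : x = v
              · subst hxv
                rw [hx.1.1 _ hv, hx'.1.1 _ hv]
              · simpa [Function.update_of_ne hxv] using congrFun h x
            rw [h2]

/-- Admissible configurations which differ from `f` somewhere on each member of `𝒯`. -/
def avoiding (f : V → A) (𝒯 : Set (Finset V)) : Set (V → A) :=
  {w | Y.Adm w ∧ ∀ T ∈ 𝒯, ∃ v ∈ T, w v ≠ f v}

lemma fillings_subset_avoiding {w f : V → A} {𝒯 : Set (Finset V)} (hw : w ∈ Y.avoiding f 𝒯)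
    [DecidableEq V] {S N B : Finset V} (hSN : S ⊆ N)
    (hS : ∀ v ∈ S, ∀ v' ∉ S, Y.nbr v v' → v' ∈ N)
    (hf : ∀ v ∈ S, ∀ v' ∈ S, Y.nbr v v' → Y.ok v v' (f v) (f v'))
    (h𝒯 : ∀ T ∈ 𝒯, ∀ v ∈ T, v ∉ N) :
    Y.fillings (fun v => if v ∈ S then f v else w v) f N ((N ∪ B) \ S) ((N ∪ B) \ S) ⊆
      {w' | w' ∈ Y.avoiding f 𝒯 ∧ (∀ v ∈ S, w' v = f v) ∧ ∀ v ∉ N ∪ B, w' v = w v} := by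
  rintro w' ⟨h1, h2, h3⟩
  have hS' : ∀ v ∈ S, w' v = f v := fun v hv => by
    simpa [hv] using h1 v (by simp [hv])
  have hoff : ∀ v ∉ N ∪ B, w' v = w v := fun v hv => by
    have : v ∉ S := fun h => hv (Finset.mem_union_left _ (hSN h))
    simpa [this] using h1 v fun h => hv (Finset.mem_sdiff.1 h).1
  refine ⟨⟨?_, ?_⟩, hS', hoff⟩
  · intro v v' hn
    by_cases hv : v ∈ (N ∪ B) \ S
    · exact h3 v hv v' hn (em _)
    by_cases hv' : v' ∈ (N ∪ B) \ S
    · exact Y.ok_symm _ _ _ _ (h3 v' hv' v (Y.nbr_symm _ _ hn) (em _))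
    have key : ∀ x, x ∉ (N ∪ B) \ S → x ∉ S → x ∉ N ∪ B := fun x hx hxS h =>
      hx (Finset.mem_sdiff.2 ⟨h, hxS⟩)
    by_cases hvS : v ∈ S
    · by_cases hvS' : v' ∈ S
      · rw [hS' v hvS, hS' v' hvS']; exact hf v hvS v' hvS' hn
      · exact absurd (Finset.mem_union_left _ (hS v hvS v' hvS' hn)) (key v' hv' hvS')
    · by_cases hvS' : v' ∈ S
      · exact absurd (Finset.mem_union_left _ (hS v' hvS' v hvS (Y.nbr_symm _ _ hn)))
          (key v hv hvS)
      · rw [hoff v (key v hv hvS), hoff v' (key v' hv' hvS')]; exact hw.1 v v' hn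
  · intro T hT
    by_cases h : ∃ v ∈ T, v ∈ N ∪ B
    · obtain ⟨v, hvT, hv⟩ := h
      have hvN := h𝒯 T hT v hvT
      exact ⟨v, hvT, (h2 v (Finset.mem_sdiff.2 ⟨hv, fun h => hvN (hSN h)⟩)).2 hvN⟩
    · push Not at h
      obtain ⟨v, hvT, hv⟩ := hw.2 T hT
      exact ⟨v, hvT, by rwa [hoff v (h v hvT)]⟩

lemma card_agreeing_le (N B : Finset V) [DecidableEq V] (w' : V → A) :
    {w : V → A | (∀ v ∈ B, w v ∉ Y.good) ∧ ∀ v ∉ N ∪ B, w' v = w v}.ncard ≤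
      Fintype.card A ^ N.card * Y.e ^ B.card := by
  classical
  set s := {w : V → A | (∀ v ∈ B, w v ∉ Y.good) ∧ ∀ v ∉ N ∪ B, w' v = w v}
  let φ : s → (N → A) × (B → {a | a ∉ Y.good}) :=
    fun w => (fun v => w.1 v, fun v => ⟨w.1 v, w.2.1 v v.2⟩)
  have hφ : Function.Injective φ := by
    rintro ⟨w, hw⟩ ⟨x, hx⟩ h
    obtain ⟨h1, h2⟩ := Prod.ext_iff.1 h
    refine Subtype.ext (funext fun v => ?_)
    by_cases hN : v ∈ N
    · exact congrFun h1 ⟨v, hN⟩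
    by_cases hB : v ∈ B
    · exact congrArg Subtype.val (congrFun h2 ⟨v, hB⟩)
    have : v ∉ N ∪ B := by simp [hN, hB]
    exact (hw.2 v this).symm.trans (hx.2 v this)
  have := Nat.card_le_card_of_injective φ hφ
  rw [Nat.card_coe_set_eq] at this
  refine this.trans ?_
  rw [Nat.card_prod, Nat.card_fun, Nat.card_fun, Nat.card_eq_fintype_card, Nat.card_coe_set_eq]
  simp only [Nat.card_eq_fintype_card, Fintype.card_coe]
  exact Nat.mul_le_mul_left _ (Nat.pow_le_pow_left Y.bad_le _)

/-- If all the neighbours of `N ∪ B` are good, then `N ∪ B` can be refilled, with `f` on `S`. -/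
lemma card_mul_le_of_closed {f : V → A} {𝒯 : Set (Finset V)} [DecidableEq V]
    {S N B Γ : Finset V} (hSN : S ⊆ N)
    (hS : ∀ v ∈ S, ∀ v' ∉ S, Y.nbr v v' → v' ∈ N ∧ f v ∈ Y.good)
    (hf : ∀ v ∈ S, ∀ v' ∈ S, Y.nbr v v' → Y.ok v v' (f v) (f v'))
    (h𝒯 : ∀ T ∈ 𝒯, ∀ v ∈ T, v ∉ N) (hBN : Disjoint B N)
    (hΓ : ∀ v ∈ N ∪ B, ∀ v' ∉ N ∪ B, Y.nbr v v' → v' ∈ Γ)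
    (hpos : 1 ≤ Fintype.card A - (Y.Δ + 2) * Y.e) :
    {w | w ∈ Y.avoiding f 𝒯 ∧ (∀ v ∈ B, w v ∉ Y.good) ∧ ∀ v ∈ Γ, w v ∈ Y.good}.ncard *
        (Fintype.card A - (Y.Δ + 2) * Y.e) ^ B.card ≤
      {w | w ∈ Y.avoiding f 𝒯 ∧ ∀ v ∈ S, w v = f v}.ncard *
        (Fintype.card A ^ N.card * Y.e ^ B.card) := by
  classical
  set P := {w | w ∈ Y.avoiding f 𝒯 ∧ (∀ v ∈ B, w v ∉ Y.good) ∧ ∀ v ∈ Γ, w v ∈ Y.good} with hP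
  set Q := {w | w ∈ Y.avoiding f 𝒯 ∧ ∀ v ∈ S, w v = f v} with hQ
  rw [Set.ncard_eq_toFinset_card' P, Set.ncard_eq_toFinset_card' Q]
  refine Finset.card_mul_le_card_mul (fun w w' => ∀ v ∉ N ∪ B, w' v = w v) ?_ ?_
  · intro w hw
    rw [Set.mem_toFinset, hP] at hw
    obtain ⟨hw, hwB, hwΓ⟩ := hw
    set base : V → A := fun v => if v ∈ S then f v else w v with hbase
    have h1 : ∀ v ∈ (N ∪ B) \ S, ∀ v' ∉ (N ∪ B) \ S, Y.nbr v v' → base v' ∈ Y.good := by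
      intro v hv v' hv' hn
      obtain ⟨hv1, hv2⟩ := Finset.mem_sdiff.1 hv
      by_cases hS' : v' ∈ S
      · rw [hbase]; simp only [if_pos hS']
        exact (hS v' hS' v hv2 (Y.nbr_symm _ _ hn)).2
      · rw [hbase]; simp only [if_neg hS']
        exact hwΓ _ (hΓ v hv1 v' (fun h => hv' (Finset.mem_sdiff.2 ⟨h, hS'⟩)) hn)
    have h2 : ∀ v ∈ (N ∪ B) \ S, v ∉ N → 1 ≤ Y.e := by
      intro v hv hvN
      have hvB : v ∈ B := by
        simp only [Finset.mem_sdiff, Finset.mem_union] at hv; tauto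
      have : 0 < {a | a ∉ Y.good}.ncard :=
        (Set.ncard_pos (Set.toFinite _)).2 ⟨w v, hwB v hvB⟩
      exact lt_of_lt_of_le this Y.bad_le
    have h3 := Y.card_fillings_ge base f N _ h1 h2 _ (Finset.Subset.refl _)
    have h4 : B.card ≤ ((N ∪ B) \ S).card := by
      refine Finset.card_le_card fun v hv => ?_
      have := Finset.disjoint_left.1 hBN hv
      exact Finset.mem_sdiff.2 ⟨Finset.mem_union_right _ hv, fun h => this (hSN h)⟩
    refine (Nat.pow_le_pow_right hpos h4).trans (h3.trans ?_)
    rw [← Set.ncard_coe_finset]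
    refine Set.ncard_le_ncard ?_ (Set.toFinite _)
    intro w' hw'
    obtain ⟨ha, hb, hc⟩ := Y.fillings_subset_avoiding hw hSN
      (fun v hv v' hv' hn => (hS v hv v' hv' hn).1) hf h𝒯 hw'
    simp only [Finset.mem_coe, Finset.mem_bipartiteAbove, Set.mem_toFinset]
    exact ⟨⟨ha, hb⟩, hc⟩
  · intro w' _
    refine le_trans ?_ (Y.card_agreeing_le N B w')
    rw [← Set.ncard_coe_finset]
    refine Set.ncard_le_ncard ?_ (Set.toFinite _)
    intro w hw
    simp only [Finset.mem_coe, Finset.mem_bipartiteBelow, Set.mem_toFinset] at hw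
    exact ⟨hw.1.2.1, hw.2⟩

/-- The unexplored neighbours of `N ∪ B`. -/
noncomputable def frontier [DecidableEq V] (N B Γ : Finset V) : Finset V := by
  classical
  exact Finset.univ.filter fun v => v ∉ N ∪ B ∧ v ∉ Γ ∧ ∃ v' ∈ N ∪ B, Y.nbr v' v

lemma mem_frontier [DecidableEq V] {N B Γ : Finset V} {v : V} :
    v ∈ Y.frontier N B Γ ↔ v ∉ N ∪ B ∧ v ∉ Γ ∧ ∃ v' ∈ N ∪ B, Y.nbr v' v := by
  simp [frontier]

/-- Exploring the cluster of bad letters around `N`: `B` is the explored bad part, `Γ` the explored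
good part. -/
lemma card_exploration_le {f : V → A} {𝒯 : Set (Finset V)} [DecidableEq V]
    {S N : Finset V} (hSN : S ⊆ N)
    (hS : ∀ v ∈ S, ∀ v' ∉ S, Y.nbr v v' → v' ∈ N ∧ f v ∈ Y.good)
    (hf : ∀ v ∈ S, ∀ v' ∈ S, Y.nbr v v' → Y.ok v v' (f v) (f v'))
    (h𝒯 : ∀ T ∈ 𝒯, ∀ v ∈ T, v ∉ N)
    (hpos : 1 ≤ Fintype.card A - (Y.Δ + 2) * Y.e) {H : ℕ} (hH : 1 ≤ H)
    (hHe : H * Y.e ≤ Fintype.card A - (Y.Δ + 2) * Y.e)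
    {l : ℝ} (hl : 1 ≤ l) (hlH : 1 + l ^ Y.Δ / H ≤ l) (m : ℕ) :
    ∀ B Γ : Finset V, Disjoint B N → (N ∪ B ∪ Γ)ᶜ.card ≤ m →
    ({w | w ∈ Y.avoiding f 𝒯 ∧ (∀ v ∈ B, w v ∉ Y.good) ∧ ∀ v ∈ Γ, w v ∈ Y.good}.ncard : ℝ) *
        (H : ℝ) ^ B.card ≤
      l ^ (Y.frontier N B Γ).card * ((Fintype.card A : ℝ) ^ N.card *
        ({w | w ∈ Y.avoiding f 𝒯 ∧ ∀ v ∈ S, w v = f v}.ncard : ℝ)) := by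
  classical
  set Q := {w | w ∈ Y.avoiding f 𝒯 ∧ ∀ v ∈ S, w v = f v} with hQ
  set P : Finset V → Finset V → Set (V → A) := fun B Γ =>
    {w | w ∈ Y.avoiding f 𝒯 ∧ (∀ v ∈ B, w v ∉ Y.good) ∧ ∀ v ∈ Γ, w v ∈ Y.good} with hP
  have hH0 : (0 : ℝ) < H := by exact_mod_cast hH
  have closed : ∀ B Γ : Finset V, Disjoint B N → Y.frontier N B Γ = ∅ →
      ((P B Γ).ncard : ℝ) * (H : ℝ) ^ B.card ≤
        l ^ (Y.frontier N B Γ).card * ((Fintype.card A : ℝ) ^ N.card * (Q.ncard : ℝ)) := by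
    intro B Γ hB hfr
    rw [hfr, Finset.card_empty, pow_zero, one_mul]
    have hΓ : ∀ v ∈ N ∪ B, ∀ v' ∉ N ∪ B, Y.nbr v v' → v' ∈ Γ := by
      intro v hv v' hv' hn
      by_contra h
      have : v' ∈ Y.frontier N B Γ := Y.mem_frontier.2 ⟨hv', h, v, hv, hn⟩
      simp [hfr] at this
    have key := Y.card_mul_le_of_closed hSN hS hf h𝒯 hB hΓ hpos
    have key2 : (P B Γ).ncard * H ^ B.card * Y.e ^ B.card ≤
        Fintype.card A ^ N.card * Q.ncard * Y.e ^ B.card := by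
      calc _ = (P B Γ).ncard * (H * Y.e) ^ B.card := by rw [mul_pow, mul_assoc]
        _ ≤ (P B Γ).ncard * (Fintype.card A - (Y.Δ + 2) * Y.e) ^ B.card :=
          Nat.mul_le_mul_left _ (Nat.pow_le_pow_left hHe _)
        _ ≤ _ := key
        _ = _ := by ring
    have key3 : (P B Γ).ncard * H ^ B.card ≤ Fintype.card A ^ N.card * Q.ncard := by
      rcases Nat.eq_zero_or_pos (Y.e ^ B.card) with h0 | h0
      · obtain ⟨he, hB0⟩ := pow_eq_zero_iff'.1 h0
        obtain ⟨v, hv⟩ := Finset.card_ne_zero.1 hB0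
        have : P B Γ = ∅ := by
          refine Set.eq_empty_of_forall_notMem fun w hw => ?_
          have h1 : 0 < {a | a ∉ Y.good}.ncard :=
            (Set.ncard_pos (Set.toFinite _)).2 ⟨w v, hw.2.1 v hv⟩
          have := Y.bad_le
          omega
        simp [this]
      · exact Nat.le_of_mul_le_mul_right key2 h0
    exact_mod_cast key3
  have hK : 0 ≤ (Fintype.card A : ℝ) ^ N.card * (Q.ncard : ℝ) := by positivity
  have hl0 : 0 < l := by linarith
  induction m with
  | zero =>
    intro B Γ hB hm
    refine closed B Γ hB (Finset.eq_empty_of_forall_notMem fun v hv => ?_)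
    obtain ⟨h1, h2, -⟩ := Y.mem_frontier.1 hv
    have : v ∈ (N ∪ B ∪ Γ)ᶜ := by
      rw [Finset.mem_compl, Finset.mem_union, not_or]; exact ⟨h1, h2⟩
    rw [Finset.card_eq_zero.1 (Nat.le_zero.1 hm)] at this
    simp at this
  | succ m ih =>
    intro B Γ hB hm
    rcases (Y.frontier N B Γ).eq_empty_or_nonempty with hfr | ⟨v, hv⟩
    · exact closed B Γ hB hfr
    obtain ⟨hv1, hv2, v₀, hv₀, hn⟩ := Y.mem_frontier.1 hv
    have hvB : v ∉ B := fun h => hv1 (Finset.mem_union_right _ h)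
    have hvN : v ∉ N := fun h => hv1 (Finset.mem_union_left _ h)
    have hvc : v ∈ (N ∪ B ∪ Γ)ᶜ := by
      rw [Finset.mem_compl, Finset.mem_union, not_or]; exact ⟨hv1, hv2⟩
    have hsub : ∀ X : Finset V, X ⊆ (N ∪ B ∪ Γ)ᶜ → v ∉ X → X.card ≤ m := by
      intro X hX hvX
      have := Finset.card_lt_card (Finset.ssubset_iff_subset_ne.2 ⟨hX, fun h => hvX (h ▸ hvc)⟩)
      omega
    have ih1 := ih (insert v B) Γ (Finset.disjoint_insert_left.2 ⟨hvN, hB⟩)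
      (hsub _ (by intro x; simp only [Finset.mem_compl, Finset.mem_union, Finset.mem_insert]; tauto)
        (by simp))
    have ih2 := ih B (insert v Γ) hB
      (hsub _ (by intro x; simp only [Finset.mem_compl, Finset.mem_union, Finset.mem_insert]; tauto)
        (by simp))
    obtain ⟨k, hk⟩ : ∃ k, (Y.frontier N B Γ).card = k + 1 :=
      Nat.exists_eq_succ_of_ne_zero (Finset.card_ne_zero.2 ⟨v, hv⟩)
    have hk' : ((Y.frontier N B Γ).erase v).card = k := by
      rw [Finset.card_erase_of_mem hv, hk]; rfl
    have hfr2 : (Y.frontier N B (insert v Γ)).card ≤ k := by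
      rw [← hk']
      refine Finset.card_le_card fun x hx => ?_
      obtain ⟨h1, h2, h3⟩ := Y.mem_frontier.1 hx
      rw [Finset.mem_insert, not_or] at h2
      exact Finset.mem_erase.2 ⟨h2.1, Y.mem_frontier.2 ⟨h1, h2.2, h3⟩⟩
    have hfr1 : (Y.frontier N (insert v B) Γ).card ≤ k + Y.Δ := by
      have h1 : (Finset.univ.filter fun v' => Y.nbr v v').card ≤ Y.Δ := by
        refine le_trans (le_of_eq ?_) (Y.deg_le v)
        rw [← Set.ncard_coe_finset]; simp
      rw [← hk']
      refine le_trans (Finset.card_le_card fun x hx => ?_)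
        ((Finset.card_union_le _ _).trans (Nat.add_le_add_left h1 _))
      obtain ⟨h1, h2, y, h3, h4⟩ := Y.mem_frontier.1 hx
      simp only [Finset.mem_union, Finset.mem_insert, not_or] at h1 h3
      by_cases hyv : y = v
      · exact Finset.mem_union_right _ (by simpa [← hyv] using h4)
      · refine Finset.mem_union_left _ (Finset.mem_erase.2 ⟨h1.2.1, Y.mem_frontier.2
          ⟨by simp [h1], h2, y, ?_, h4⟩⟩)
        simp only [Finset.mem_union]; tauto
    have hsplit : (P B Γ).ncard ≤ (P (insert v B) Γ).ncard + (P B (insert v Γ)).ncard := by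
      refine le_trans (Set.ncard_le_ncard (fun w hw => ?_) (Set.toFinite _))
        (Set.ncard_union_le _ _)
      obtain ⟨h1, h2, h3⟩ := hw
      by_cases hg : w v ∈ Y.good
      · exact Or.inr ⟨h1, h2, fun x hx => (Finset.mem_insert.1 hx).elim (fun h => h ▸ hg) (h3 x)⟩
      · exact Or.inl ⟨h1, fun x hx => (Finset.mem_insert.1 hx).elim (fun h => h ▸ hg) (h2 x), h3⟩
    rw [Finset.card_insert_of_notMem hvB, pow_succ, ← mul_assoc] at ih1
    set K := (Fintype.card A : ℝ) ^ N.card * (Q.ncard : ℝ) with hKdef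
    have b1 : ((P (insert v B) Γ).ncard : ℝ) * (H : ℝ) ^ B.card ≤ l ^ (k + Y.Δ) * K / H := by
      rw [le_div_iff₀ hH0]
      exact ih1.trans (mul_le_mul_of_nonneg_right (pow_le_pow_right₀ hl hfr1) hK)
    have b2 : ((P B (insert v Γ)).ncard : ℝ) * (H : ℝ) ^ B.card ≤ l ^ k * K :=
      ih2.trans (mul_le_mul_of_nonneg_right (pow_le_pow_right₀ hl hfr2) hK)
    have b3 : ((P B Γ).ncard : ℝ) ≤ (P (insert v B) Γ).ncard + (P B (insert v Γ)).ncard := by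
      exact_mod_cast hsplit
    calc ((P B Γ).ncard : ℝ) * (H : ℝ) ^ B.card
        ≤ ((P (insert v B) Γ).ncard + (P B (insert v Γ)).ncard) * (H : ℝ) ^ B.card :=
          mul_le_mul_of_nonneg_right b3 (by positivity)
      _ ≤ l ^ (k + Y.Δ) * K / H + l ^ k * K := by rw [add_mul]; exact add_le_add b1 b2
      _ = (l ^ k * K) * (1 + l ^ Y.Δ / H) := by rw [pow_add]; ring
      _ ≤ (l ^ k * K) * l := mul_le_mul_of_nonneg_left hlH (by positivity)
      _ = _ := by rw [hk, pow_succ]; ring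

lemma card_avoiding_le {f : V → A} {𝒯 : Set (Finset V)} {S N : Finset V} (hSN : S ⊆ N)
    (hS : ∀ v ∈ S, ∀ v' ∉ S, Y.nbr v v' → v' ∈ N ∧ f v ∈ Y.good)
    (hf : ∀ v ∈ S, ∀ v' ∈ S, Y.nbr v v' → Y.ok v v' (f v) (f v'))
    (h𝒯 : ∀ T ∈ 𝒯, ∀ v ∈ T, v ∉ N)
    (hpos : 1 ≤ Fintype.card A - (Y.Δ + 2) * Y.e) {H : ℕ} (hH : 1 ≤ H)
    (hHe : H * Y.e ≤ Fintype.card A - (Y.Δ + 2) * Y.e)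
    {l : ℝ} (hl : 1 ≤ l) (hlH : 1 + l ^ Y.Δ / H ≤ l) {κ : ℕ} (hκ : N.card ≤ κ) :
    ((Y.avoiding f 𝒯).ncard : ℝ) ≤ l ^ (Y.Δ * κ) * (Fintype.card A : ℝ) ^ κ *
        ({w | w ∈ Y.avoiding f 𝒯 ∧ ∀ v ∈ S, w v = f v}.ncard : ℝ) := by
  classical
  have h := Y.card_exploration_le hSN hS hf h𝒯 hpos hH hHe hl hlH _ ∅ ∅
    (Finset.disjoint_empty_left _) le_rfl
  simp only [Finset.notMem_empty, false_imp_iff, implies_true, and_true, Finset.card_empty,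
    pow_zero, mul_one, Set.ofPred_mem_eq] at h
  refine h.trans ?_
  rw [mul_assoc]
  have hA : (1 : ℝ) ≤ Fintype.card A := by
    have : 1 ≤ Fintype.card A := hpos.trans (Nat.sub_le _ _)
    exact_mod_cast this
  have hfr : (Y.frontier N ∅ ∅).card ≤ Y.Δ * κ := by
    have : Y.frontier N ∅ ∅ ⊆ N.biUnion fun v => Finset.univ.filter fun v' => Y.nbr v v' := by
      intro x hx
      obtain ⟨-, -, y, hy, hyx⟩ := Y.mem_frontier.1 hx
      simp only [Finset.union_empty] at hy
      simpa using ⟨y, hy, hyx⟩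
    refine (Finset.card_le_card this).trans ((Finset.card_biUnion_le_card_mul _ _ Y.Δ ?_).trans ?_)
    · intro v _
      refine le_trans (le_of_eq ?_) (Y.deg_le v)
      rw [← Set.ncard_coe_finset]; simp
    · rw [mul_comm]; exact Nat.mul_le_mul_left _ hκ
  have hl0 : 0 < l := by linarith
  gcongr

/-- Avoiding `f` on each of a family of well separated places costs a factor exponential in the size
of the family. -/
lemma card_avoiding_family_le {ι : Type} {f : V → A} {S N : ι → Finset V}
    (hSN : ∀ i, S i ⊆ N i)
    (hS : ∀ i, ∀ v ∈ S i, ∀ v' ∉ S i, Y.nbr v v' → v' ∈ N i ∧ f v ∈ Y.good)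
    (hf : ∀ i, ∀ v ∈ S i, ∀ v' ∈ S i, Y.nbr v v' → Y.ok v v' (f v) (f v'))
    (hdisj : ∀ i j, i ≠ j → Disjoint (N i) (N j))
    (hpos : 1 ≤ Fintype.card A - (Y.Δ + 2) * Y.e) {H : ℕ} (hH : 1 ≤ H)
    (hHe : H * Y.e ≤ Fintype.card A - (Y.Δ + 2) * Y.e)
    {l : ℝ} (hl : 1 ≤ l) (hlH : 1 + l ^ Y.Δ / H ≤ l) {κ : ℕ} (hκ : ∀ i, (N i).card ≤ κ)
    (I : Finset ι) :
    ((Y.avoiding f (S '' I)).ncard : ℝ) ≤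
      (1 - (l ^ (Y.Δ * κ) * (Fintype.card A : ℝ) ^ κ)⁻¹) ^ I.card *
        ({w | Y.Adm w}.ncard : ℝ) := by
  classical
  have hA : (1 : ℝ) ≤ Fintype.card A := by
    have : 1 ≤ Fintype.card A := hpos.trans (Nat.sub_le _ _)
    exact_mod_cast this
  set K := l ^ (Y.Δ * κ) * (Fintype.card A : ℝ) ^ κ with hK
  have hK1 : 1 ≤ K := one_le_mul_of_one_le_of_one_le (one_le_pow₀ hl) (one_le_pow₀ hA)
  have hK0 : 0 < K := by linarith
  have hKi : 0 ≤ 1 - K⁻¹ := by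
    have := inv_le_one_of_one_le₀ hK1
    linarith
  induction I using Finset.induction_on with
  | empty => simp [avoiding]
  | insert j I hj ih =>
    have h𝒯 : ∀ T ∈ S '' (I : Set ι), ∀ v ∈ T, v ∉ N j := by
      rintro _ ⟨i, hi, rfl⟩ v hv hvj
      exact Finset.disjoint_left.1 (hdisj i j fun h => hj (h ▸ hi)) (hSN i hv) hvj
    have h1 := Y.card_avoiding_le (hSN j) (hS j) (hf j) h𝒯 hpos hH hHe hl hlH (hκ j)
    set R := {w | w ∈ Y.avoiding f (S '' I) ∧ ∀ v ∈ S j, w v = f v}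
    have h2 : Y.avoiding f (S '' ↑(insert j I)) = Y.avoiding f (S '' I) \ R := by
      ext w
      simp only [avoiding, R, Finset.coe_insert, Set.image_insert_eq, Set.mem_insert_iff,
        forall_eq_or_imp, Set.mem_ofPred_eq, Set.mem_sdiff, not_and, not_forall]
      constructor
      · rintro ⟨ha, ⟨v, hv, hv'⟩, hc⟩
        exact ⟨⟨ha, hc⟩, fun _ => ⟨v, hv, hv'⟩⟩
      · rintro ⟨⟨ha, hc⟩, h⟩
        obtain ⟨v, hv, hv'⟩ := h ⟨ha, hc⟩
        exact ⟨ha, ⟨v, hv, hv'⟩, hc⟩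
    have h3 : (Y.avoiding f (S '' ↑(insert j I))).ncard + R.ncard =
        (Y.avoiding f (S '' I)).ncard := by
      rw [h2]
      exact Set.ncard_sdiff_add_ncard_of_subset (fun w hw => hw.1) (Set.toFinite _)
    have h4 : ((Y.avoiding f (S '' ↑(insert j I))).ncard : ℝ) + R.ncard =
        (Y.avoiding f (S '' I)).ncard := by exact_mod_cast h3
    have h5 : K⁻¹ * ((Y.avoiding f (S '' I)).ncard : ℝ) ≤ R.ncard := by
      rw [inv_mul_le_iff₀ hK0]; exact h1
    rw [Finset.card_insert_of_notMem hj, pow_succ]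
    calc _ ≤ (1 - K⁻¹) * ((Y.avoiding f (S '' I)).ncard : ℝ) := by linarith
      _ ≤ (1 - K⁻¹) * ((1 - K⁻¹) ^ I.card * ({w | Y.Adm w}.ncard : ℝ)) :=
          mul_le_mul_of_nonneg_left ih hKi
      _ = _ := by ring

end GoodSystem

section Sites

variable {d : ℕ} {A : Type}

lemma unitVec_injective : Function.Injective (unitVec d) := by
  intro i j h
  by_contra hij
  have := congrFun h i
  simp [unitVec, hij] at this

lemma unitVec_add_ne_zero (i j : Fin d) : unitVec d i + unitVec d j ≠ 0 := by
  intro h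
  have := congrFun h i
  simp only [Pi.add_apply, unitVec, Pi.zero_apply] at this
  split_ifs at this <;> simp_all

lemma adjSites.symm {u v : Site d} (h : adjSites u v) : adjSites v u := by
  obtain ⟨i, h⟩ := h
  exact ⟨i, h.symm⟩

lemma adjSites_sub {u v t : Site d} : adjSites (u - t) (v - t) ↔ adjSites u v := by
  refine exists_congr fun i => ?_
  have h : ∀ a b : Site d, a - t = b - t + unitVec d i ↔ a = b + unitVec d i := by
    intro a b
    rw [sub_add_eq_add_sub, sub_left_inj]
  rw [h, h]

/-- The site of the cube `[1, M]^d` with the given index. -/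
def siteOf {M : ℕ} (p : Fin d → Fin M) : Site d := fun i => (p i : ℤ) + 1

lemma siteOf_injective {M : ℕ} : Function.Injective (siteOf : (Fin d → Fin M) → Site d) := by
  intro p q h
  funext i
  have := congrFun h i
  simp only [siteOf] at this
  exact Fin.ext (by omega)

lemma ncard_nbr_le {M : ℕ} (v : Fin d → Fin M) :
    {v' : Fin d → Fin M | adjSites (siteOf v) (siteOf v')}.ncard ≤ 2 * d := by
  classical
  let T : Set (Site d) := Set.range fun q : Fin d × Bool =>
    if q.2 then siteOf v + unitVec d q.1 else siteOf v - unitVec d q.1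
  have h1 : T.ncard ≤ 2 * d := by
    have : Set.ncard (Set.univ : Set (Fin d × Bool)) = 2 * d := by
      rw [Set.ncard_univ, Nat.card_eq_fintype_card]; simp [mul_comm]
    rw [← this]
    simp only [T, ← Set.image_univ]
    exact Set.ncard_image_le (Set.toFinite _)
  refine le_trans (Set.ncard_le_ncard_of_injOn siteOf ?_ siteOf_injective.injOn (Set.toFinite _)) h1
  rintro v' ⟨i, h | h⟩
  · exact ⟨(i, true), by simp [h]⟩
  · exact ⟨(i, false), by simp [h]⟩

end Sites

namespace NNSFT

variable {d : ℕ} {A : Type} [Fintype A]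

/-- The constraint system which `X` induces on the cube `[1, M]^d`. -/
def system (X : NNSFT d A) (G : Set A) (e : ℕ) (hbad : {a | a ∉ G}.ncard ≤ e)
    (hok : ∀ g ∈ G, ∀ i, {a | ¬ X.adj i g a}.ncard ≤ e ∧ {a | ¬ X.adj i a g}.ncard ≤ e) (M : ℕ) :
    GoodSystem (Fin d → Fin M) A where
  nbr v v' := adjSites (siteOf v) (siteOf v')
  nbr_symm _ _ h := h.symm
  nbr_irrefl v := by
    rintro ⟨i, h⟩
    rw [or_self] at h
    have := congrFun h i
    simp [unitVec] at this
  ok v v' a b := ∀ i, (siteOf v' = siteOf v + unitVec d i → X.adj i a b) ∧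
    (siteOf v = siteOf v' + unitVec d i → X.adj i b a)
  ok_symm _ _ _ _ h i := (h i).symm
  good := G
  Δ := 2 * d
  e := e
  deg_le := ncard_nbr_le
  bad_le := hbad
  ok_le v v' g hn hg := by
    obtain ⟨i, h | h⟩ := hn
    · refine le_trans (Set.ncard_le_ncard ?_ (Set.toFinite _)) (hok g hg i).2
      intro a ha hadj
      refine ha fun j => ⟨fun h' => ?_, fun h' => ?_⟩
      · rw [h, add_right_inj] at h'
        rwa [← unitVec_injective h']
      · rw [h, add_assoc, left_eq_add] at h'
        exact absurd h' (unitVec_add_ne_zero _ _)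
    · refine le_trans (Set.ncard_le_ncard ?_ (Set.toFinite _)) (hok g hg i).1
      intro a ha hadj
      refine ha fun j => ⟨fun h' => ?_, fun h' => ?_⟩
      · rw [h, add_assoc, left_eq_add] at h'
        exact absurd h' (unitVec_add_ne_zero _ _)
      · rw [h, add_right_inj] at h'
        rwa [← unitVec_injective h']

/-- Configurations on `[1, M]^d` without forbidden pairs. -/
def cubeAdm (X : NNSFT d A) (M : ℕ) : Set ((Fin d → Fin M) → A) :=
  {w | ∀ v v' i, siteOf v' = siteOf v + unitVec d i → X.adj i (w v) (w v')}

lemma system_adm (X : NNSFT d A) (G : Set A) (e : ℕ) (hbad : {a | a ∉ G}.ncard ≤ e)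
    (hok : ∀ g ∈ G, ∀ i, {a | ¬ X.adj i g a}.ncard ≤ e ∧ {a | ¬ X.adj i a g}.ncard ≤ e) (M : ℕ) :
    {w | (X.system G e hbad hok M).Adm w} = X.cubeAdm M := by
  ext w
  constructor
  · intro h v v' i hv
    exact (h v v' ⟨i, Or.inl hv⟩ i).1 hv
  · intro h v v' _ i
    exact ⟨h v v' i, h v' v i⟩

lemma exists_radius [Nonempty A] (X : NNSFT d A) (n : ℕ) :
    ∃ r : ℕ, ∀ x : Site d → A, X.locAdm {v | ∀ i, 1 - (r : ℤ) ≤ v i ∧ v i ≤ n + r} x →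
      (cube d n).domRestrict x ∈ X.langSet (cube d n) := by
  by_contra! hcon
  let _ : TopologicalSpace A := ⊥
  have : DiscreteTopology A := ⟨rfl⟩
  have hfin : (cube d n).Finite := by
    have : cube d n = Set.Icc (fun _ => (1 : ℤ)) (fun _ => (n : ℤ)) := by
      ext v; simp [cube, Set.mem_Icc, Pi.le_def, forall_and]
    rw [this]; exact Set.finite_Icc _ _
  have := hfin.to_subtype
  let F : ℕ → Set (Site d → A) := fun r =>
    {x | X.locAdm {v | ∀ i, 1 - (r : ℤ) ≤ v i ∧ v i ≤ n + r} x ∧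
      (cube d n).domRestrict x ∉ X.langSet (cube d n)}
  have hclosed : ∀ r, IsClosed (F r) := by
    intro r
    refine IsClosed.inter (s₁ := {x | X.locAdm _ x}) ?_ ?_
    · simp only [locAdm]
      have : {x : Site d → A | ∀ (i : Fin d) (v : Site d),
          v ∈ {v : Site d | ∀ i, 1 - (r : ℤ) ≤ v i ∧ v i ≤ n + r} →
          v + unitVec d i ∈ {v : Site d | ∀ i, 1 - (r : ℤ) ≤ v i ∧ v i ≤ n + r} →
          X.adj i (x v) (x (v + unitVec d i))} =
          ⋂ (i : Fin d) (v : Site d)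
          (_ : v ∈ {v : Site d | ∀ i, 1 - (r : ℤ) ≤ v i ∧ v i ≤ n + r})
          (_ : v + unitVec d i ∈ {v : Site d | ∀ i, 1 - (r : ℤ) ≤ v i ∧ v i ≤ n + r}),
          (fun x : Site d → A => (x v, x (v + unitVec d i))) ⁻¹' {q | X.adj i q.1 q.2} := by
        ext x; simp
      rw [this]
      refine isClosed_iInter fun i => isClosed_iInter fun v => isClosed_iInter fun _ =>
        isClosed_iInter fun _ => ?_
      exact (isClosed_discrete _).preimage ((continuous_apply _).prodMk (continuous_apply _))
    · have hc : Continuous fun x : Site d → A => (cube d n).domRestrict x :=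
        continuous_pi fun v => continuous_apply (v : Site d)
      exact (isClosed_discrete (X.langSet (cube d n))ᶜ).preimage hc
  have hanti : ∀ i, F (i + 1) ⊆ F i := by
    rintro r x ⟨h1, h2⟩
    refine ⟨fun i v hv hv' => h1 i v (fun j => ?_) (fun j => ?_), h2⟩
    · have := hv j; push_cast; constructor <;> omega
    · have := hv' j; push_cast; constructor <;> omega
  obtain ⟨x, hx⟩ := IsCompact.nonempty_iInter_of_sequence_nonempty_isCompact_isClosed F hanti
    (fun r => by obtain ⟨x, hx, hx'⟩ := hcon r; exact ⟨x, hx, hx'⟩)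
    (hclosed 0).isCompact hclosed
  rw [Set.mem_iInter] at hx
  refine (hx 0).2 ⟨x, fun i v => ?_, rfl⟩
  let r : ℕ := ∑ j, (|v j|.toNat + 2)
  have hr : ∀ j, |v j| + 2 ≤ (r : ℤ) := by
    intro j
    have : |v j|.toNat + 2 ≤ r :=
      Finset.single_le_sum (f := fun j => |v j|.toNat + 2) (fun _ _ => Nat.zero_le _)
        (Finset.mem_univ j)
    have := abs_nonneg (v j)
    omega
  have hb : ∀ j, 1 - (r : ℤ) ≤ v j ∧ v j + 1 ≤ n + r := by
    intro j
    have h1 := hr j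
    have h2 := le_abs_self (v j)
    have h3 := neg_abs_le (v j)
    constructor <;> omega
  refine (hx r).1 i v (fun j => ?_) (fun j => ?_)
  · have := hb j; constructor <;> omega
  · have := hb j
    simp only [Pi.add_apply, unitVec]
    split_ifs <;> constructor <;> omega

lemma exists_card_cubeAdm_le [Nonempty A] (X : NNSFT d A) (n : ℕ) (hn : 0 < n) :
    ∃ r : ℕ, ∀ k : ℕ, 0 < k → (X.cubeAdm (k * n + 2 * r)).ncard ≤
      X.langCard (cube d n) ^ k ^ d *
        Fintype.card A ^ ((k * n + 2 * r) ^ d - (k * n) ^ d) := by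
  classical
  obtain ⟨r, hr⟩ := X.exists_radius n
  refine ⟨r, fun k hk => ?_⟩
  set M := k * n + 2 * r with hM
  have hM0 : 0 < M := by positivity
  have hfin : (cube d n).Finite := by
    have : cube d n = Set.Icc (fun _ => (1 : ℤ)) (fun _ => (n : ℤ)) := by
      ext v; simp [cube, Set.mem_Icc, Pi.le_def, forall_and]
    rw [this]; exact Set.finite_Icc _ _
  have := hfin.to_subtype
  let idx : Site d → Fin d → Fin M := fun z i =>
    if h : (z i - 1).toNat < M then ⟨(z i - 1).toNat, h⟩ else ⟨0, hM0⟩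
  have idx_site : ∀ v, idx (siteOf v) = v := by
    intro v; funext i; simp [idx, siteOf]
  have site_idx : ∀ z : Site d, (∀ i, 1 ≤ z i ∧ z i ≤ M) → siteOf (idx z) = z := by
    intro z hz; funext i
    have h := hz i
    have h' : (z i - 1).toNat < M := by omega
    simp only [siteOf, idx, dif_pos h']
    omega
  let pos : (Fin d → Fin k) → Site d → Site d := fun p z i => z i + (r + n * (p i : ℕ) : ℕ)
  have hpos : ∀ p z, (∀ i, 1 - (r : ℤ) ≤ z i ∧ z i ≤ (n : ℤ) + r) →
      ∀ i, 1 ≤ pos p z i ∧ pos p z i ≤ M := by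
    intro p z hz i
    have h1 := hz i
    have h2 : n * (p i : ℕ) + n ≤ k * n := by
      have := (p i).2
      calc n * (p i : ℕ) + n = ((p i : ℕ) + 1) * n := by ring
        _ ≤ k * n := Nat.mul_le_mul_right _ this
    simp only [pos, hM]
    push_cast
    zify at h2
    constructor
    · have : (0 : ℤ) ≤ n * (p i : ℕ) := by positivity
      linarith
    · linarith
  have hlang : ∀ w ∈ X.cubeAdm M, ∀ p, (cube d n).domRestrict (fun z => w (idx (pos p z))) ∈
      X.langSet (cube d n) := by
    intro w hw p
    refine hr _ fun i v hv hv' => hw _ _ i ?_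
    rw [site_idx _ (hpos p _ hv), site_idx _ (hpos p _ hv')]
    funext j
    simp only [pos, Pi.add_apply]
    ring
  let core : Set (Fin d → Fin M) := {v | ∀ i, r ≤ (v i : ℕ) ∧ (v i : ℕ) < r + k * n}
  let φ : X.cubeAdm M → ((Fin d → Fin k) → X.langSet (cube d n)) × (↥coreᶜ → A) :=
    fun w => (fun p => ⟨_, hlang w.1 w.2 p⟩, fun v => w.1 v)
  have hφ : Function.Injective φ := by
    rintro ⟨w, hw⟩ ⟨w', hw'⟩ h
    obtain ⟨h1, h2⟩ := Prod.ext_iff.1 h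
    refine Subtype.ext (funext fun v => ?_)
    by_cases hv : v ∈ core
    · have hlt : ∀ i, ((v i : ℕ) - r) / n < k := fun i => by
        have := hv i
        rw [Nat.div_lt_iff_lt_mul hn]; omega
      let p : Fin d → Fin k := fun i => ⟨((v i : ℕ) - r) / n, hlt i⟩
      let z : cube d n := ⟨fun i => ((((v i : ℕ) - r) % n : ℕ) : ℤ) + 1, fun i => by
        have := Nat.mod_lt ((v i : ℕ) - r) hn
        simp only
        constructor <;> omega⟩
      have hz : pos p z = siteOf v := by
        funext i
        have h3 := Nat.mod_add_div ((v i : ℕ) - r) n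
        have := (hv i).1
        simp only [pos, p, z, siteOf]
        omega
      have := congrFun (congrArg Subtype.val (congrFun h1 p)) z
      simpa [φ, Set.domRestrict, hz, idx_site] using this
    · exact congrFun h2 ⟨v, hv⟩
  have hcore : core.ncard = (k * n) ^ d := by
    have : core = ↑(Fintype.piFinset fun _ : Fin d =>
        Finset.univ.filter fun a : Fin M => r ≤ (a : ℕ) ∧ (a : ℕ) < r + k * n) := by
      ext v; simp [core]
    rw [this, Set.ncard_coe_finset, Fintype.card_piFinset, Finset.prod_const, Finset.card_univ,
      Fintype.card_fin]
    congr 1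
    rw [← Finset.card_map Fin.valEmbedding]
    have : (Finset.univ.filter fun a : Fin M => r ≤ (a : ℕ) ∧ (a : ℕ) < r + k * n).map
        Fin.valEmbedding = Finset.Ico r (r + k * n) := by
      ext a
      simp only [Finset.mem_map, Finset.mem_filter, Finset.mem_univ, true_and,
        Fin.valEmbedding_apply, Finset.mem_Ico]
      constructor
      · rintro ⟨b, hb, rfl⟩; exact hb
      · intro ha; exact ⟨⟨a, by omega⟩, ha, rfl⟩
    rw [this, Nat.card_Ico]; omega
  have hcompl : coreᶜ.ncard = M ^ d - (k * n) ^ d := by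
    have := Set.ncard_add_ncard_compl core
    rw [hcore, Nat.card_eq_fintype_card, Fintype.card_fun, Fintype.card_fin, Fintype.card_fin]
      at this
    omega
  have := Nat.card_le_card_of_injective φ hφ
  rwa [Nat.card_prod, Nat.card_fun, Nat.card_fun, Nat.card_fun, Nat.card_coe_set_eq,
    Nat.card_coe_set_eq, Nat.card_coe_set_eq, hcompl, Nat.card_eq_fintype_card (α := A),
    Nat.card_fin, Nat.card_fin] at this

end NNSFT

section Measures

variable {d : ℕ} {A : Type}

lemma measurableSet_letter (z : Site d) (a : A) : MeasurableSet {x : Site d → A | x z = a} :=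
  (@measurable_pi_apply (Site d) (fun _ => A) (fun _ => ⊤) z) (t := {a}) trivial

lemma measurableSet_cylEvent {S : Set (Site d)} (hS : S.Finite) (u : Site d → A) :
    MeasurableSet (cylEvent S u) := by
  have : cylEvent S u = ⋂ v ∈ S, {x | x v = u v} := by ext x; simp [cylEvent]
  rw [this]
  exact hS.measurableSet_biInter fun v _ => measurableSet_letter v _

lemma measurable_shiftMap (t : Site d) :
    Measurable (shiftMap t : (Site d → A) → Site d → A) :=
  @measurable_pi_lambda _ _ _ _ (fun _ => ⊤) _
    fun v => @measurable_pi_apply (Site d) (fun _ => A) (fun _ => ⊤) (v + t)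

/-- Configurations whose restriction to `[1, M]^d` is `w`. -/
def cubeEvent {M : ℕ} (w : (Fin d → Fin M) → A) : Set (Site d → A) :=
  {x | ∀ p, x (siteOf p) = w p}

lemma measurableSet_cubeEvent {M : ℕ} (w : (Fin d → Fin M) → A) :
    MeasurableSet (cubeEvent w) := by
  have : cubeEvent w = ⋂ p, {x | x (siteOf p) = w p} := by ext x; simp [cubeEvent]
  rw [this]
  exact MeasurableSet.iInter fun p => measurableSet_letter _ _

/-- The patterns on `[1, M]^d` of positive measure. -/
def cubeSupp (μ : Measure (Site d → A)) (M : ℕ) : Set ((Fin d → Fin M) → A) :=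
  {w | μ (cubeEvent w) ≠ 0}

lemma cubeSupp_subset_cubeAdm [Fintype A] {X : NNSFT d A} {μ : Measure (Site d → A)}
    [IsProbabilityMeasure μ] (hX : μ X.pts = 1) (M : ℕ) : cubeSupp μ M ⊆ X.cubeAdm M := by
  intro w hw
  obtain ⟨x, hx, hxw⟩ : ∃ x ∈ X.pts, x ∈ cubeEvent w := by
    by_contra! h
    refine hw ((prob_compl_eq_one_iff (measurableSet_cubeEvent w)).1 (le_antisymm prob_le_one ?_))
    rw [← hX]
    exact measure_mono h
  intro v v' i hv
  rw [← hxw v, ← hxw v', hv]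
  exact hx i _

variable [Fintype A]

lemma sum_cubeEvent (μ : Measure (Site d → A)) [IsProbabilityMeasure μ] (M : ℕ) :
    ∑ w : (Fin d → Fin M) → A, (μ (cubeEvent w)).toReal = 1 := by
  classical
  let g : (Site d → A) → (Fin d → Fin M) → A := fun x p => x (siteOf p)
  have hg : ∀ w, g ⁻¹' {w} = cubeEvent w := by
    intro w; ext x
    simp only [Set.mem_preimage, Set.mem_singleton_iff, funext_iff, g, cubeEvent]
    rfl
  have h := sum_measure_preimage_singleton (μ := μ) (f := g) Finset.univ
    fun w _ => by rw [hg]; exact measurableSet_cubeEvent w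
  simp only [hg, Finset.coe_univ, Set.preimage_univ, measure_univ] at h
  rw [← ENNReal.toReal_sum fun w _ => measure_ne_top μ _, h, ENNReal.toReal_one]

lemma blockEnt_le_log (μ : Measure (Site d → A)) [IsProbabilityMeasure μ] (M : ℕ) :
    0 < (cubeSupp μ M).ncard ∧ blockEnt μ M ≤ Real.log (cubeSupp μ M).ncard := by
  classical
  have hsum := sum_cubeEvent μ M
  set q : ((Fin d → Fin M) → A) → ℝ := fun w => (μ (cubeEvent w)).toReal with hq
  have hq0 : ∀ w, w ∉ cubeSupp μ M → q w = 0 := by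
    intro w hw
    have : μ (cubeEvent w) = 0 := not_not.1 hw
    simp [hq, this]
  have hpos : 0 < (cubeSupp μ M).ncard := by
    refine (Set.ncard_pos (Set.toFinite _)).2 ?_
    by_contra h
    rw [Set.not_nonempty_iff_eq_empty] at h
    rw [Finset.sum_eq_zero fun w _ => hq0 w (by simp [h])] at hsum
    exact zero_ne_one hsum
  refine ⟨hpos, ?_⟩
  set n : ℝ := ((cubeSupp μ M).ncard : ℝ) with hn
  have hn0 : 0 < n := Nat.cast_pos.2 hpos
  have hterm : ∀ w, Real.negMulLog (q w) ≤
      q w * Real.log n - q w + if w ∈ cubeSupp μ M then n⁻¹ else 0 := by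
    intro w
    by_cases hw : w ∈ cubeSupp μ M
    · have hqw : 0 < q w := ENNReal.toReal_pos hw (measure_ne_top μ _)
      have h1 := Real.log_le_sub_one_of_pos (x := (n * q w)⁻¹) (by positivity)
      rw [Real.log_inv, Real.log_mul hn0.ne' hqw.ne'] at h1
      have h2 := mul_le_mul_of_nonneg_left h1 hqw.le
      have h3 : q w * ((n * q w)⁻¹ - 1) = n⁻¹ - q w := by field_simp
      rw [if_pos hw, Real.negMulLog]
      linarith
    · rw [if_neg hw, hq0 w hw]; simp
  have hcount : ∑ w : (Fin d → Fin M) → A, (if w ∈ cubeSupp μ M then n⁻¹ else 0) = 1 := by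
    rw [← Finset.sum_filter, Finset.sum_const, nsmul_eq_mul]
    have : (Finset.univ.filter fun w => w ∈ cubeSupp μ M).card = (cubeSupp μ M).ncard := by
      rw [← Set.ncard_coe_finset]; simp
    rw [this, ← hn, mul_inv_cancel₀ hn0.ne']
  calc blockEnt μ M = ∑ w, Real.negMulLog (q w) := rfl
    _ ≤ ∑ w, (q w * Real.log n - q w + if w ∈ cubeSupp μ M then n⁻¹ else 0) :=
      Finset.sum_le_sum fun w _ => hterm w
    _ = Real.log n := by
      rw [Finset.sum_add_distrib, Finset.sum_sub_distrib, ← Finset.sum_mul, hsum, hcount]; ring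

lemma blockEnt_nonneg (μ : Measure (Site d → A)) [IsProbabilityMeasure μ] (M : ℕ) :
    0 ≤ blockEnt μ M :=
  Finset.sum_nonneg fun _ _ => Real.negMulLog_nonneg ENNReal.toReal_nonneg
    (by rw [← ENNReal.toReal_one]; exact ENNReal.toReal_mono ENNReal.one_ne_top prob_le_one)

lemma measEnt_nonneg (μ : Measure (Site d → A)) [IsProbabilityMeasure μ] : 0 ≤ measEnt μ :=
  Real.iInf_nonneg fun n => div_nonneg (blockEnt_nonneg μ n) (by positivity)

lemma measEnt_mul_le (μ : Measure (Site d → A)) [IsProbabilityMeasure μ] {M : ℕ} (hM : 0 < M) :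
    measEnt μ * (M : ℝ) ^ d ≤ blockEnt μ M := by
  have h : measEnt μ ≤ blockEnt μ M / (M : ℝ) ^ d :=
    ciInf_le (f := fun n : ℕ+ => blockEnt μ n / ((n : ℕ) : ℝ) ^ d)
      ⟨0, by rintro _ ⟨n, rfl⟩; exact div_nonneg (blockEnt_nonneg μ n) (by positivity)⟩ ⟨M, hM⟩
  have : (0 : ℝ) < (M : ℝ) ^ d := by positivity
  rwa [le_div_iff₀ this] at h

end Measures

section Planting

variable {d : ℕ} {A : Type}

/-- The position of a site inside its block of side `2 R + 3`, relative to the block centre. -/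
def blockOffset {M : ℕ} (R : ℕ) (v : Fin d → Fin M) : Site d :=
  fun i => (((v i : ℕ) % (2 * R + 3) : ℕ) : ℤ) - (R + 1)

lemma blockOffset_of_adjSites {M R : ℕ} {v v' : Fin d → Fin M}
    (hv : blockOffset R v ∈ symBox d R) (h : adjSites (siteOf v) (siteOf v')) :
    (∀ i, (v' i : ℕ) / (2 * R + 3) = (v i : ℕ) / (2 * R + 3)) ∧
      siteOf v' - blockOffset R v' = siteOf v - blockOffset R v := by
  have key : ∀ i, (v' i : ℕ) / (2 * R + 3) = (v i : ℕ) / (2 * R + 3) ∧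
      ((v' i : ℕ) : ℤ) - ((v' i : ℕ) % (2 * R + 3) : ℕ) =
        ((v i : ℕ) : ℤ) - ((v i : ℕ) % (2 * R + 3) : ℕ) := by
    intro i
    have h1 : ((v' i : ℕ) : ℤ) ≤ (v i : ℕ) + 1 ∧ ((v i : ℕ) : ℤ) ≤ (v' i : ℕ) + 1 := by
      obtain ⟨j, h | h⟩ := h <;>
      · have := congrFun h i
        simp only [siteOf, Pi.add_apply, unitVec] at this
        split_ifs at this <;> constructor <;> omega
    have h2 : |(((v i : ℕ) % (2 * R + 3) : ℕ) : ℤ) - (R + 1)| ≤ R := hv i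
    rw [abs_le] at h2
    have h3 := Nat.div_add_mod (v i : ℕ) (2 * R + 3)
    have h4 : (v' i : ℕ) = (2 * R + 3) * ((v i : ℕ) / (2 * R + 3)) +
        ((v' i : ℕ) + (v i : ℕ) % (2 * R + 3) - (v i : ℕ)) := by omega
    have h5 : (v' i : ℕ) + (v i : ℕ) % (2 * R + 3) - (v i : ℕ) < 2 * R + 3 := by omega
    have h6 : (v' i : ℕ) / (2 * R + 3) = (v i : ℕ) / (2 * R + 3) := by
      rw [h4, Nat.mul_add_div (by omega), Nat.div_eq_of_lt h5, add_zero]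
    refine ⟨h6, ?_⟩
    have h7 := Nat.div_add_mod (v' i : ℕ) (2 * R + 3)
    rw [h6] at h7
    omega
  refine ⟨fun i => (key i).1, funext fun i => ?_⟩
  have := (key i).2
  simp only [siteOf, blockOffset, Pi.sub_apply]
  omega

/-- The block of side `2 R + 3` with index `p`. -/
def block (M R : ℕ) (p : Fin d → ℕ) : Finset (Fin d → Fin M) :=
  Finset.univ.filter fun v => ∀ i, (v i : ℕ) / (2 * R + 3) = p i

lemma card_block_le (M R : ℕ) (p : Fin d → ℕ) : (block M R p).card ≤ (2 * R + 3) ^ d := by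
  have : (2 * R + 3) ^ d = (Finset.univ : Finset (Fin d → Fin (2 * R + 3))).card := by simp
  rw [this]
  refine Finset.card_le_card_of_injOn
    (fun v i => ⟨(v i : ℕ) % (2 * R + 3), Nat.mod_lt _ (by omega)⟩) (by simp) ?_
  intro v hv v' hv' h
  simp only [block, Finset.coe_filter, Finset.mem_univ, true_and, Set.mem_ofPred_eq] at hv hv'
  funext i
  have h1 := congrArg Fin.val (congrFun h i)
  simp only at h1
  have h2 := Nat.div_add_mod (v i : ℕ) (2 * R + 3)
  have h3 := Nat.div_add_mod (v' i : ℕ) (2 * R + 3)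
  rw [hv i] at h2
  rw [hv' i] at h3
  exact Fin.ext (by omega)

open Classical in
/-- The copy of `S` in the block with index `p`. -/
noncomputable def planted (M R : ℕ) (S : Set (Site d)) (p : Fin d → ℕ) :
    Finset (Fin d → Fin M) :=
  (block M R p).filter fun v => blockOffset R v ∈ S

variable [Fintype A]

lemma cubeSupp_subset_avoiding {X : NNSFT d A} {G : Set A} {e : ℕ}
    {hbad : {a | a ∉ G}.ncard ≤ e}
    {hok : ∀ g ∈ G, ∀ i, {a | ¬ X.adj i g a}.ncard ≤ e ∧ {a | ¬ X.adj i a g}.ncard ≤ e}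
    {μ : Measure (Site d → A)} [IsProbabilityMeasure μ] (hinv : shiftInv μ) (hX : μ X.pts = 1)
    {S : Set (Site d)} (hS : S.Finite) {u : Site d → A} (hu : μ (cylEvent S u) = 0)
    {R M J : ℕ} (hR : S ⊆ symBox d R) (hJ : (2 * R + 3) * J ≤ M) :
    cubeSupp μ M ⊆ (X.system G e hbad hok M).avoiding (fun v => u (blockOffset R v))
      ((planted M R S) '' ↑(Fintype.piFinset fun _ : Fin d => Finset.range J)) := by
  intro w hw
  have hadm := cubeSupp_subset_cubeAdm hX M hw
  rw [← X.system_adm G e hbad hok] at hadm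
  refine ⟨hadm, ?_⟩
  rintro _ ⟨p, hp, rfl⟩
  by_contra! h
  let t : Site d := fun i => (((2 * R + 3) * p i + R + 2 : ℕ) : ℤ)
  refine hw (measure_mono_null (t := shiftMap t ⁻¹' cylEvent S u) ?_ ?_)
  · intro x hx z hz
    have hlt : ∀ i, ∃ a : ℕ, (a : ℤ) = z i + (R + 1) ∧ a < 2 * R + 3 ∧
        (2 * R + 3) * p i + a < M := by
      intro i
      have h1 := abs_le.1 (hR hz i)
      have h2 : p i < J := by simpa using (Fintype.mem_piFinset.1 hp) i
      have h3 : (2 * R + 3) * p i + (2 * R + 3) ≤ (2 * R + 3) * J := by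
        calc (2 * R + 3) * p i + (2 * R + 3) = (2 * R + 3) * (p i + 1) := by ring
          _ ≤ _ := Nat.mul_le_mul_left _ h2
      exact ⟨(z i + (R + 1)).toNat, by omega, by omega, by omega⟩
    choose a ha1 ha2 ha3 using hlt
    let v : Fin d → Fin M := fun i => ⟨(2 * R + 3) * p i + a i, ha3 i⟩
    have hoff : blockOffset R v = z := by
      funext i
      simp only [blockOffset, v, Nat.mul_add_mod, Nat.mod_eq_of_lt (ha2 i)]
      have := ha1 i
      omega
    have hsite : siteOf v = z + t := by
      funext i
      simp only [siteOf, v, t, Pi.add_apply]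
      have := ha1 i
      push_cast
      omega
    have hv : v ∈ planted M R S p := by
      simp only [planted, block, Finset.mem_filter, Finset.mem_univ, true_and]
      refine ⟨fun i => ?_, by rwa [hoff]⟩
      simp only [v]
      rw [Nat.mul_add_div (by omega), Nat.div_eq_of_lt (ha2 i), add_zero]
    have h1 := h v hv
    rw [hoff] at h1
    rw [← h1, ← hx v, hsite]
    rfl
  · rw [← Measure.map_apply (measurable_shiftMap t) (measurableSet_cylEvent hS u), hinv t, hu]

lemma card_planted_avoiding_le {X : NNSFT d A} {G : Set A} {e : ℕ}
    {hbad : {a | a ∉ G}.ncard ≤ e}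
    {hok : ∀ g ∈ G, ∀ i, {a | ¬ X.adj i g a}.ncard ≤ e ∧ {a | ¬ X.adj i a g}.ncard ≤ e}
    {S : Set (Site d)} {u : Site d → A} (hu : X.globAdm S u) (huG : ∀ v ∈ innerBd S, u v ∈ G)
    {R : ℕ} (hR : S ⊆ symBox d R)
    (hpos : 1 ≤ Fintype.card A - (2 * d + 2) * e) {H : ℕ} (hH : 1 ≤ H)
    (hHe : H * e ≤ Fintype.card A - (2 * d + 2) * e)
    {l : ℝ} (hl : 1 ≤ l) (hlH : 1 + l ^ (2 * d) / H ≤ l) (M J : ℕ) :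
    (((X.system G e hbad hok M).avoiding (fun v => u (blockOffset R v))
      ((planted M R S) '' ↑(Fintype.piFinset fun _ : Fin d => Finset.range J))).ncard : ℝ) ≤
    (1 - (l ^ (2 * d * (2 * R + 3) ^ d) * (Fintype.card A : ℝ) ^ (2 * R + 3) ^ d)⁻¹) ^ J ^ d *
      ((X.cubeAdm M).ncard : ℝ) := by
  classical
  have hmem : ∀ p (v : Fin d → Fin M), v ∈ planted M R S p ↔
      v ∈ block M R p ∧ blockOffset R v ∈ S := by simp [planted]
  have hblock : ∀ p (v : Fin d → Fin M), v ∈ block M R p ↔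
      ∀ i, (v i : ℕ) / (2 * R + 3) = p i := by simp [block]
  have hadj : ∀ v v' : Fin d → Fin M, blockOffset R v ∈ S → adjSites (siteOf v) (siteOf v') →
      siteOf v' - blockOffset R v' = siteOf v - blockOffset R v :=
    fun v v' hv h => (blockOffset_of_adjSites (hR hv) h).2
  have h := (X.system G e hbad hok M).card_avoiding_family_le
    (f := fun v => u (blockOffset R v)) (S := planted M R S) (N := block M R)
    (fun p => Finset.filter_subset _ _) ?_ ?_ ?_ hpos hH hHe hl hlH
    (fun p => card_block_le M R p) (Fintype.piFinset fun _ : Fin d => Finset.range J)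
  · rwa [Fintype.card_piFinset, Finset.prod_const, Finset.card_univ, Fintype.card_fin,
      Finset.card_range, X.system_adm G e hbad hok] at h
  · intro p v hv v' hv' hn
    obtain ⟨hvb, hvS⟩ := (hmem p v).1 hv
    have hb' : v' ∈ block M R p := (hblock p v').2 fun i => by
      rw [(blockOffset_of_adjSites (hR hvS) hn).1 i]; exact (hblock p v).1 hvb i
    refine ⟨hb', huG _ ⟨hvS, blockOffset R v', fun h => hv' ((hmem p v').2 ⟨hb', h⟩), ?_⟩⟩
    have h1 := hadj v v' hvS hn
    have h2 : blockOffset R v = siteOf v - (siteOf v - blockOffset R v) := by abel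
    have h3 : blockOffset R v' = siteOf v' - (siteOf v - blockOffset R v) := by
      rw [← h1]; abel
    rw [h2, h3, adjSites_sub]
    exact hn
  · intro p v hv v' hv' hn
    obtain ⟨x, hx, hxu⟩ := hu
    have hvS := ((hmem p v).1 hv).2
    have hvS' := ((hmem p v').1 hv').2
    have h1 := hadj v v' hvS hn
    have h3 : blockOffset R v' = siteOf v' - (siteOf v - blockOffset R v) := by
      rw [← h1]; abel
    refine fun i => ⟨fun h => ?_, fun h => ?_⟩
    · have : blockOffset R v' = blockOffset R v + unitVec d i := by rw [h3, h]; abel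
      rw [← hxu _ hvS, ← hxu _ hvS', this]
      exact hx i _
    · have : blockOffset R v = blockOffset R v' + unitVec d i := by
        rw [h3, sub_add_eq_add_sub, ← h]; abel
      rw [← hxu _ hvS, ← hxu _ hvS', this]
      exact hx i _
  · intro p q hpq
    refine Finset.disjoint_left.2 fun v hv hv' => hpq (funext fun i => ?_)
    rw [← (hblock p v).1 hv i, (hblock q v).1 hv' i]

end Planting

section EntropyGap

variable {d : ℕ} {A : Type} [Fintype A]

lemma measEnt_mul_add_le [Nonempty A] (X : NNSFT d A) (μ : Measure (Site d → A))
    [IsProbabilityMeasure μ] {K : ℝ} (hK : 1 ≤ K) {s : ℕ} (hs : 0 < s)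
    (h : ∀ M J : ℕ, s * J ≤ M →
      ((cubeSupp μ M).ncard : ℝ) ≤ (1 - K⁻¹) ^ J ^ d * ((X.cubeAdm M).ncard : ℝ))
    {n : ℕ} (hn : 0 < n) :
    ∃ r : ℕ, ∀ j : ℕ, 0 < j → measEnt μ * (n : ℝ) ^ d + (n : ℝ) ^ d / (K * (s : ℝ) ^ d) ≤
      Real.log (X.langCard (cube d n)) +
        (((n : ℝ) + 2 * r / (s * j)) ^ d - (n : ℝ) ^ d) * Real.log (Fintype.card A) := by
  obtain ⟨r, hr⟩ := X.exists_card_cubeAdm_le n hn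
  refine ⟨r, fun j hj => ?_⟩
  have hk : 0 < s * j := by positivity
  set M := s * j * n + 2 * r with hM
  have hM0 : 0 < M := by positivity
  obtain ⟨hpos, hlog⟩ := blockEnt_le_log μ M
  have hJ := h M (n * j) (by rw [hM]; nlinarith)
  have hadm := hr (s * j) hk
  rw [← hM] at hadm
  have hle : (s * j * n) ^ d ≤ M ^ d := Nat.pow_le_pow_left (by omega) d
  have ha : (0 : ℝ) < Fintype.card A := Nat.cast_pos.2 Fintype.card_pos
  have hsupp : (0 : ℝ) < (cubeSupp μ M).ncard := Nat.cast_pos.2 hpos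
  have hadm0 : 0 < (X.cubeAdm M).ncard := by
    by_contra h0
    rw [Nat.le_zero.1 (not_lt.1 h0), Nat.cast_zero, mul_zero] at hJ
    exact hsupp.not_ge hJ
  have hlang : (0 : ℝ) < X.langCard (cube d n) := by
    refine Nat.cast_pos.2 (Nat.pos_of_ne_zero fun h0 => ?_)
    rw [h0, zero_pow (by positivity), zero_mul] at hadm
    omega
  have hexp : (1 - K⁻¹) ^ (n * j) ^ d ≤ Real.exp (-(K⁻¹ * ((n * j : ℕ) : ℝ) ^ d)) := by
    calc (1 - K⁻¹) ^ (n * j) ^ d ≤ Real.exp (-K⁻¹) ^ (n * j) ^ d := by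
          refine pow_le_pow_left₀ (sub_nonneg.2 (inv_le_one_of_one_le₀ hK)) ?_ _
          linarith [Real.add_one_le_exp (-K⁻¹)]
      _ = _ := by rw [← Real.exp_nat_mul]; push_cast; congr 1; ring
  have hadmR : ((X.cubeAdm M).ncard : ℝ) ≤ (X.langCard (cube d n) : ℝ) ^ (s * j) ^ d *
      (Fintype.card A : ℝ) ^ (M ^ d - (s * j * n) ^ d) := by exact_mod_cast hadm
  have hbound := hJ.trans (mul_le_mul hexp hadmR (Nat.cast_nonneg _) (Real.exp_pos _).le)
  have hlog' := Real.log_le_log hsupp hbound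
  rw [Real.log_mul (Real.exp_pos _).ne' (by positivity), Real.log_exp,
    Real.log_mul (by positivity) (by positivity), Real.log_pow, Real.log_pow,
    Nat.cast_sub hle] at hlog'
  have hent := (measEnt_mul_le μ hM0).trans (hlog.trans hlog')
  have hsj : (0 : ℝ) < ((s : ℝ) * j) ^ d := by positivity
  have hMk : (M : ℝ) ^ d = ((s : ℝ) * j) ^ d * ((n : ℝ) + 2 * r / (s * j)) ^ d := by
    rw [← mul_pow]; congr 1; rw [hM]; push_cast; field_simp
  have hnM : (n : ℝ) ^ d ≤ ((n : ℝ) + 2 * r / (s * j)) ^ d :=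
    pow_le_pow_left₀ (by positivity) (le_add_of_nonneg_right (by positivity)) d
  have hmono := mul_le_mul_of_nonneg_left hnM (measEnt_nonneg μ)
  push_cast at hent
  rw [hMk] at hent
  refine le_of_mul_le_mul_left ?_ hsj
  have hc : ((s : ℝ) * j) ^ d * ((n : ℝ) ^ d / (K * (s : ℝ) ^ d)) =
      K⁻¹ * ((n : ℝ) * j) ^ d := by
    have : K ≠ 0 := by positivity
    rw [mul_pow, mul_pow]; field_simp
  have hmono' := mul_le_mul_of_nonneg_left hmono hsj.le
  have hsplit : ((s : ℝ) * j * n) ^ d = ((s : ℝ) * j) ^ d * (n : ℝ) ^ d := mul_pow _ _ _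
  rw [hsplit] at hent
  rw [mul_add, hc]
  linarith

/-- If the words charged by `μ` are exponentially fewer than the admissible ones, then `μ` does
not have maximal entropy. -/
lemma measEnt_lt_entropy [Nonempty A] (X : NNSFT d A) (μ : Measure (Site d → A))
    [IsProbabilityMeasure μ] {K : ℝ} (hK : 1 ≤ K) {s : ℕ} (hs : 0 < s)
    (h : ∀ M J : ℕ, s * J ≤ M →
      ((cubeSupp μ M).ncard : ℝ) ≤ (1 - K⁻¹) ^ J ^ d * ((X.cubeAdm M).ncard : ℝ)) :
    measEnt μ < X.entropy := by
  have hc : 0 < 1 / (K * (s : ℝ) ^ d) := by positivity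
  refine (lt_add_of_pos_right _ hc).trans_le (le_ciInf fun n => ?_)
  obtain ⟨r, hr⟩ := measEnt_mul_add_le X μ hK hs h n.pos
  have hlim : Filter.Tendsto (fun j : ℕ => Real.log (X.langCard (cube d (n : ℕ))) +
      ((((n : ℕ) : ℝ) + 2 * r / (s * j)) ^ d - ((n : ℕ) : ℝ) ^ d) * Real.log (Fintype.card A))
      Filter.atTop (nhds (Real.log (X.langCard (cube d (n : ℕ))) +
        ((((n : ℕ) : ℝ) + 0) ^ d - ((n : ℕ) : ℝ) ^ d) * Real.log (Fintype.card A))) := by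
    have h0 : Filter.Tendsto (fun j : ℕ => 2 * (r : ℝ) / (s * j)) Filter.atTop (nhds 0) := by
      simp_rw [← div_div]
      exact tendsto_const_div_atTop_nhds_zero_nat _
    exact ((((h0.const_add _).pow d).sub_const _).mul_const _).const_add _
  have hle := ge_of_tendsto hlim (Filter.eventually_atTop.2 ⟨1, fun j hj => hr j hj⟩)
  have hnd : (0 : ℝ) < ((n : ℕ) : ℝ) ^ d := by have := n.pos; positivity
  rw [le_div_iff₀ hnd]
  rw [add_zero, sub_self, zero_mul, add_zero] at hle
  calc _ = measEnt μ * ((n : ℕ) : ℝ) ^ d + ((n : ℕ) : ℝ) ^ d / (K * (s : ℝ) ^ d) := by ring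
    _ ≤ _ := hle

end EntropyGap

section Fullness

variable {d : ℕ} {A : Type}

lemma exists_subset_symBox {S : Set (Site d)} (hS : S.Finite) : ∃ R : ℕ, S ⊆ symBox d R := by
  classical
  refine ⟨hS.toFinset.sup fun v => Finset.univ.sup fun i => (v i).natAbs, fun v hv i => ?_⟩
  rw [Int.abs_eq_natAbs]
  exact_mod_cast (Finset.le_sup (f := fun i => (v i).natAbs) (Finset.mem_univ i)).trans
    (Finset.le_sup (f := fun v : Site d => Finset.univ.sup fun i => (v i).natAbs)
      (hS.mem_toFinset.2 hv))

lemma ncard_compl_le_card_div [Fintype A] {N : ℕ} (hN : 0 < N) {T : Set A}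
    (hT : (T.ncard : ℝ) > (1 - 1 / (N : ℝ)) * Fintype.card A) :
    Tᶜ.ncard ≤ Fintype.card A / N := by
  rw [Nat.le_div_iff_mul_le hN]
  have hsum := Set.ncard_add_ncard_compl T
  rw [Nat.card_eq_fintype_card] at hsum
  have hsumR : (T.ncard : ℝ) + Tᶜ.ncard = Fintype.card A := by exact_mod_cast hsum
  have hN' : (0 : ℝ) < N := Nat.cast_pos.2 hN
  have h1 : (Tᶜ.ncard : ℝ) < Fintype.card A / N := by
    have : (1 - 1 / (N : ℝ)) * Fintype.card A = Fintype.card A - Fintype.card A / N := by ring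
    linarith
  rw [lt_div_iff₀ hN'] at h1
  exact_mod_cast h1.le

lemma one_add_pow_div_le {d : ℕ} (hd : 1 ≤ d) :
    1 + (1 + 1 / (2 * (d : ℝ))) ^ (2 * d) / ((6 * d : ℕ) : ℝ) ≤ 1 + 1 / (2 * (d : ℝ)) := by
  have hd0 : (0 : ℝ) < d := Nat.cast_pos.2 hd
  have h1 : (1 + 1 / (2 * (d : ℝ))) ^ (2 * d) ≤ 3 := by
    calc (1 + 1 / (2 * (d : ℝ))) ^ (2 * d) ≤ Real.exp (1 / (2 * (d : ℝ))) ^ (2 * d) :=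
          pow_le_pow_left₀ (by positivity) (by linarith [Real.add_one_le_exp (1 / (2 * (d : ℝ)))]) _
      _ = Real.exp 1 := by
          rw [← Real.exp_nat_mul]; congr 1; push_cast; field_simp
      _ ≤ 3 := Real.exp_one_lt_three.le
  have h2 : (1 + 1 / (2 * (d : ℝ))) ^ (2 * d) / ((6 * d : ℕ) : ℝ) ≤ 3 / ((6 * d : ℕ) : ℝ) := by
    gcongr
  have h3 : 3 / ((6 * d : ℕ) : ℝ) = 1 / (2 * (d : ℝ)) := by push_cast; field_simp; norm_num
  linarith

end Fullness

theorem good_boundary_positive_measure {d : ℕ} {A : Type} [Fintype A]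
    (X : NNSFT d A) (hd : 1 ≤ d) (G : Set A)
    (hfull : X.epsFullWith (1 / (3 ^ 3 * 2 ^ 11 * (d : ℝ) ^ 8)) G)
    (μ : Measure (Site d → A)) (hμ : X.isMME μ)
    (huniq : ∀ ν : Measure (Site d → A), X.isMME ν → ν = μ)
    (S : Set (Site d)) (hS : S.Finite) (u : Site d → A)
    (hu : X.globAdm S u) (huG : ∀ v ∈ innerBd S, u v ∈ G) :
    0 < μ (cylEvent S u) := by
  obtain ⟨hprob, hinv, hX, hent⟩ := hμ
  have hne : Nonempty A := ⟨u 0⟩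
  obtain ⟨hG, hadj⟩ := hfull
  set N : ℕ := 3 ^ 3 * 2 ^ 11 * d ^ 8 with hN
  have hNR : 3 ^ 3 * 2 ^ 11 * (d : ℝ) ^ 8 = (N : ℝ) := by rw [hN]; push_cast; ring
  rw [hNR] at hG hadj
  have hN0 : 0 < N := by positivity
  set e := Fintype.card A / N with he
  have hbad : {a | a ∉ G}.ncard ≤ e := ncard_compl_le_card_div hN0 hG
  have hok : ∀ g ∈ G, ∀ i, {a | ¬ X.adj i g a}.ncard ≤ e ∧ {a | ¬ X.adj i a g}.ncard ≤ e :=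
    fun g hg i => ⟨ncard_compl_le_card_div hN0 (hadj g hg i).1,
      ncard_compl_le_card_div hN0 (hadj g hg i).2⟩
  have hNe : N * e ≤ Fintype.card A := Nat.mul_div_le _ _
  have hd8 : d ≤ d ^ 8 := Nat.le_self_pow (by norm_num) d
  have hNd : 6 * d + (2 * d + 2) + 1 ≤ N := by rw [hN]; omega
  have hsmall : (6 * d + (2 * d + 2) + 1) * e ≤ Fintype.card A :=
    (Nat.mul_le_mul_right e hNd).trans hNe
  have hA : 0 < Fintype.card A := Fintype.card_pos
  have hHe : 6 * d * e ≤ Fintype.card A - (2 * d + 2) * e := by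
    apply Nat.le_sub_of_add_le; linarith
  have hpos : 1 ≤ Fintype.card A - (2 * d + 2) * e := by
    apply Nat.le_sub_of_add_le
    rcases Nat.eq_zero_or_pos e with h0 | h0
    · rw [h0]; omega
    · nlinarith
  obtain ⟨R, hR⟩ := exists_subset_symBox hS
  have hl : (1 : ℝ) ≤ 1 + 1 / (2 * (d : ℝ)) := le_add_of_nonneg_right (by positivity)
  rw [pos_iff_ne_zero]
  intro h0
  refine (measEnt_lt_entropy X μ (s := 2 * R + 3)
    (one_le_mul_of_one_le_of_one_le (one_le_pow₀ (n := 2 * d * (2 * R + 3) ^ d) hl)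
      (one_le_pow₀ (n := (2 * R + 3) ^ d) (Nat.one_le_cast.2 hA))) (by positivity)
    fun M J hJ => ?_).ne hent
  refine le_trans ?_ (card_planted_avoiding_le (hbad := hbad) (hok := hok) hu huG hR hpos
    (by omega) hHe hl (one_add_pow_div_le hd) M J)
  exact Nat.cast_le.2 (Set.ncard_le_ncard
    (cubeSupp_subset_avoiding hinv hX hS h0 hR hJ) (Set.toFinite _))
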